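/- Let q be a prime power, K a finite field with q elements, K̄ an algebraic closure of K, and φ the Frobenius map on P¹(K̄) given by [a : b] ↦ [a^q : b^q]. The number of orbits of the componentwise action of PGL₂(K) on the set of ordered 6-tuples (x₁, …, x₆) of pairwise distinct points of P¹(K̄) satisfying φ(x₁) = x₂, φ(x₂) = x₃, φ(x₃) = x₄, φ(x₄) = x₁, φ(x₅) = x₅ and φ(x₆) = x₆ equals q³ + q². -/

import Mathlib

open Projectivization

/-! ## The projective line and the actions of `GL₂` and `PGL₂` -/

/-- `GL₂(L)` as a group of linear automorphisms of `L²`. -/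
noncomputable def glMulEquiv (L : Type*) [Field L] :
    GL (Fin 2) L ≃* ((Fin 2 → L) ≃ₗ[L] (Fin 2 → L)) :=
  (Matrix.GeneralLinearGroup.toLin).trans
    (LinearMap.GeneralLinearGroup.generalLinearEquiv L (Fin 2 → L))

theorem glMulEquiv_apply (L : Type*) [Field L] (g : GL (Fin 2) L) (v : Fin 2 → L) :
    glMulEquiv L g v = (g : Matrix (Fin 2) (Fin 2) L).mulVec v := by
  simp [glMulEquiv]

/-- The action of `GL₂(L)` on the projective line `P¹(L)`, given in homogeneous
coordinates by `[a : b] ↦ [α a + β b : γ a + δ b]`. -/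
noncomputable def glP1 (L : Type*) [Field L] :
    GL (Fin 2) L →* Function.End (Projectivization L (Fin 2 → L)) where
  toFun g := Projectivization.map (glMulEquiv L g).toLinearMap (glMulEquiv L g).injective
  map_one' := by
    funext x
    induction x using Projectivization.ind with
    | h v hv =>
      show Projectivization.map (glMulEquiv L 1).toLinearMap (glMulEquiv L 1).injective
          (Projectivization.mk L v hv) = Projectivization.mk L v hv
      rw [Projectivization.map_mk, Projectivization.mk_eq_mk_iff']
      exact ⟨1, by simp [glMulEquiv_apply]⟩
  map_mul' g h := by
    funext x
    induction x using Projectivization.ind with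
    | h v hv =>
      show Projectivization.map (glMulEquiv L (g * h)).toLinearMap
          (glMulEquiv L (g * h)).injective (Projectivization.mk L v hv)
        = Projectivization.map (glMulEquiv L g).toLinearMap (glMulEquiv L g).injective
            (Projectivization.map (glMulEquiv L h).toLinearMap (glMulEquiv L h).injective
              (Projectivization.mk L v hv))
      rw [Projectivization.map_mk, Projectivization.map_mk, Projectivization.map_mk,
        Projectivization.mk_eq_mk_iff']
      exact ⟨1, by simp [glMulEquiv_apply, Matrix.mulVec_mulVec]⟩

/-- The action of `GL₂(L)` on `P¹(L)` as a `MulAction`. -/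
noncomputable instance glP1Action (L : Type*) [Field L] :
    MulAction (GL (Fin 2) L) (Projectivization L (Fin 2 → L)) :=
  MulAction.ofEndHom (glP1 L)

/-- The subgroup of scalar matrices inside `GL₂(L)`. -/
def scalarSubgroup (L : Type*) [Field L] : Subgroup (GL (Fin 2) L) :=
  (Units.map ((Matrix.scalar (Fin 2)) : L →+* Matrix (Fin 2) (Fin 2) L).toMonoidHom).range

instance scalarSubgroup_normal (L : Type*) [Field L] : (scalarSubgroup L).Normal := by
  constructor
  rintro n ⟨a, rfl⟩ g
  refine ⟨a, ?_⟩
  have hc : Commute (Units.map ((Matrix.scalar (Fin 2)) :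
      L →+* Matrix (Fin 2) (Fin 2) L).toMonoidHom a) g := by
    apply Units.ext
    simpa using (Matrix.scalar_commute (a : L) (fun r => mul_comm _ _)
      (g : Matrix (Fin 2) (Fin 2) L)).eq
  rw [← hc.eq, mul_assoc, mul_inv_cancel, mul_one]

/-- `PGL₂(K)`: the quotient of `GL₂(K)` by the subgroup of scalar matrices. -/
abbrev PGL2 (K : Type*) [Field K] := GL (Fin 2) K ⧸ scalarSubgroup K

/-- Scalar matrices act trivially on the projective line. -/
theorem glP1_scalar_eq_one (L : Type*) [Field L] (a : Lˣ) :
    glP1 L (Units.map ((Matrix.scalar (Fin 2)) :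
      L →+* Matrix (Fin 2) (Fin 2) L).toMonoidHom a) = 1 := by
  set u := Units.map ((Matrix.scalar (Fin 2)) :
      L →+* Matrix (Fin 2) (Fin 2) L).toMonoidHom a with hu
  funext x
  induction x using Projectivization.ind with
  | h v hv =>
    show Projectivization.map (glMulEquiv L u).toLinearMap (glMulEquiv L u).injective
        (Projectivization.mk L v hv) = Projectivization.mk L v hv
    rw [Projectivization.map_mk, Projectivization.mk_eq_mk_iff']
    refine ⟨(a : L), ?_⟩
    simp [glMulEquiv_apply, hu, Matrix.scalar_apply, Matrix.diagonal_const_mulVec]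

/-- For a field homomorphism `f : K →+* L`, the scalar matrices of `GL₂(K)` act trivially on
`P¹(L)`, hence the action of `GL₂(K)` on `P¹(L)` descends to an action of `PGL₂(K)`. -/
noncomputable def pglP1 {K L : Type*} [Field K] [Field L] (f : K →+* L) :
    PGL2 K →* Function.End (Projectivization L (Fin 2 → L)) :=
  QuotientGroup.lift (scalarSubgroup K)
    ((glP1 L).comp (Matrix.GeneralLinearGroup.map f))
    (by
      rintro z ⟨a, rfl⟩
      have key : Matrix.GeneralLinearGroup.map (n := Fin 2) f
          (Units.map ((Matrix.scalar (Fin 2)) : K →+* Matrix (Fin 2) (Fin 2) K).toMonoidHom a)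
          = Units.map ((Matrix.scalar (Fin 2)) :
              L →+* Matrix (Fin 2) (Fin 2) L).toMonoidHom (Units.map f.toMonoidHom a) := by
        apply Units.ext
        ext i j
        simp [Matrix.GeneralLinearGroup.map, Matrix.scalar_apply, Matrix.diagonal,
          Matrix.map_apply, apply_ite f]
      rw [MonoidHom.mem_ker, MonoidHom.comp_apply, key, glP1_scalar_eq_one])

/-- The action of `PGL₂(K)` on `P¹(L)`, for any extension `L` of `K` via `f : K →+* L`. -/
noncomputable def pglP1Action {K L : Type*} [Field K] [Field L] (f : K →+* L) :
    MulAction (PGL2 K) (Projectivization L (Fin 2 → L)) :=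
  MulAction.ofEndHom (pglP1 f)
/-- The Frobenius map on the projective line `P¹(L)`, acting in homogeneous coordinates by
`[a : b] ↦ [a ^ q : b ^ q]`. -/
noncomputable def frobP1 {L : Type*} [Field L] (q : ℕ)
    (x : Projectivization L (Fin 2 → L)) : Projectivization L (Fin 2 → L) :=
  Projectivization.mk L (fun i => (x.rep i) ^ q) (by
    intro hzero
    obtain ⟨i, hi⟩ := Function.ne_iff.mp x.rep_nonzero
    have h2 : x.rep i ^ q = 0 := congrFun hzero i
    exact hi (by simpa using (pow_eq_zero_iff'.mp h2).1))

noncomputable instance pglP1ClosureAction (K : Type*) [Field K] :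
    MulAction (PGL2 K)
      (Projectivization (AlgebraicClosure K) (Fin 2 → AlgebraicClosure K)) :=
  pglP1Action (algebraMap K (AlgebraicClosure K))

section CountingFrobeniusOrbits

open Polynomial

variable {K : Type*} [Field K]

/-- The projective line over the algebraic closure of `K`. -/
abbrev ClosureLine (K : Type*) [Field K] :=
  Projectivization (AlgebraicClosure K) (Fin 2 → AlgebraicClosure K)

/-- The affine point `[a : 1]`. -/
noncomputable def affinePoint (a : AlgebraicClosure K) : ClosureLine K :=
  Projectivization.mk _ ![a, 1] (fun h => one_ne_zero (congrFun h 1))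

/-- The point `[1 : 0]`. -/
noncomputable def infinityPoint (K : Type*) [Field K] : ClosureLine K :=
  Projectivization.mk _ ![1, 0] (fun h => one_ne_zero (congrFun h 0))

theorem affinePoint_injective :
    Function.Injective (affinePoint : AlgebraicClosure K → ClosureLine K) := by
  intro a b h
  obtain ⟨c, hc⟩ := (Projectivization.mk_eq_mk_iff' _ _ _ _ _).1 h
  have h0 := congrFun hc 0
  have h1 := congrFun hc 1
  simp at h0 h1
  simp [← h0, h1]

theorem affinePoint_ne_infinityPoint (a : AlgebraicClosure K) :
    affinePoint a ≠ infinityPoint K := by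
  intro h
  obtain ⟨c, hc⟩ := (Projectivization.mk_eq_mk_iff' _ _ _ _ _).1 h
  simpa using congrFun hc 1

theorem eq_infinityPoint_or_affinePoint (x : ClosureLine K) :
    x = infinityPoint K ∨ ∃ a, x = affinePoint a := by
  induction x using Projectivization.ind with
  | h v hv =>
    by_cases h1 : v 1 = 0
    · left
      refine (Projectivization.mk_eq_mk_iff' _ _ _ _ _).2 ⟨v 0, ?_⟩
      ext i
      fin_cases i <;> simp [h1]
    · right
      refine ⟨v 0 / v 1, (Projectivization.mk_eq_mk_iff' _ _ _ _ _).2 ⟨v 1, ?_⟩⟩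
      ext i
      fin_cases i
      · simp [mul_div_cancel₀ _ h1]
      · simp

theorem pgl2_smul_mk (g : GL (Fin 2) K) (v : Fin 2 → AlgebraicClosure K) (hv : v ≠ 0)
    (hgv : ((g : Matrix (Fin 2) (Fin 2) K).map (algebraMap K (AlgebraicClosure K))).mulVec v ≠ 0) :
    (QuotientGroup.mk g : PGL2 K) • (Projectivization.mk (AlgebraicClosure K) v hv) =
      Projectivization.mk _
        (((g : Matrix (Fin 2) (Fin 2) K).map (algebraMap K (AlgebraicClosure K))).mulVec v) hgv := by
  change Projectivization.map
    (glMulEquiv _ (Matrix.GeneralLinearGroup.map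
      (algebraMap K (AlgebraicClosure K)) g)).toLinearMap (LinearEquiv.injective _)
    (Projectivization.mk _ v hv) = _
  rw [Projectivization.map_mk, Projectivization.mk_eq_mk_iff']
  exact ⟨1, by rw [one_smul]; exact (glMulEquiv_apply (AlgebraicClosure K)
    (Matrix.GeneralLinearGroup.map (algebraMap K (AlgebraicClosure K)) g) v).symm⟩

theorem map_mulVec_ne_zero (g : GL (Fin 2) K) {v : Fin 2 → AlgebraicClosure K} (hv : v ≠ 0) :
    ((g : Matrix (Fin 2) (Fin 2) K).map (algebraMap K (AlgebraicClosure K))).mulVec v ≠ 0 := by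
  intro h
  apply hv
  apply (glMulEquiv _
    (Matrix.GeneralLinearGroup.map (algebraMap K (AlgebraicClosure K)) g)).injective
  rw [map_zero, glMulEquiv_apply]
  exact h

theorem frobP1_mk {L : Type*} [Field L] {q : ℕ} (v : Fin 2 → L) (hv : v ≠ 0)
    (hv' : (fun i => v i ^ q) ≠ 0) :
    frobP1 q (Projectivization.mk L v hv) = Projectivization.mk L (fun i => v i ^ q) hv' := by
  obtain ⟨a, ha⟩ := Projectivization.exists_smul_eq_mk_rep L v hv
  refine (Projectivization.mk_eq_mk_iff' _ _ _ _ _).2 ⟨(a : L) ^ q, ?_⟩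
  ext i
  simp [← ha, Units.smul_def, mul_pow]

/-- Scaling by an element of `Kˣ` is induced by an element of `PGL₂(K)` fixing `[1 : 0]`. -/
theorem exists_smul_eq_affinePoint_mul (c : Kˣ) :
    ∃ g : PGL2 K, g • infinityPoint K = infinityPoint K ∧
      ∀ a : AlgebraicClosure K,
        g • affinePoint a = affinePoint (algebraMap K _ c * a) := by
  have hdet : (!![(c : K), 0; 0, 1] : Matrix (Fin 2) (Fin 2) K).det ≠ 0 := by simp
  refine ⟨QuotientGroup.mk (Matrix.GeneralLinearGroup.mkOfDetNeZero _ hdet), ?_, fun a => ?_⟩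
  · rw [infinityPoint,
      pgl2_smul_mk _ _ _ (map_mulVec_ne_zero _ fun h => one_ne_zero (congrFun h 0)),
      Projectivization.mk_eq_mk_iff']
    refine ⟨algebraMap K _ c, funext fun i => ?_⟩
    fin_cases i <;> simp [Matrix.GeneralLinearGroup.mkOfDetNeZero, Matrix.mulVec, dotProduct]
  · rw [affinePoint, pgl2_smul_mk _ _ _ (map_mulVec_ne_zero _ fun h => one_ne_zero (congrFun h 1)),
      affinePoint, Projectivization.mk_eq_mk_iff']
    refine ⟨1, funext fun i => ?_⟩
    fin_cases i <;> simp [Matrix.GeneralLinearGroup.mkOfDetNeZero, Matrix.mulVec, dotProduct]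

/-- An element of `PGL₂(K)` fixing `[1 : 0]` and `[0 : 1]` acts by scaling. -/
theorem exists_scaling_of_smul_eq {g : PGL2 K} (hinf : g • infinityPoint K = infinityPoint K)
    (hzero : g • (affinePoint 0 : ClosureLine K) = affinePoint 0) :
    ∃ c : Kˣ, ∀ a : AlgebraicClosure K, g • affinePoint a = affinePoint (algebraMap K _ c * a) := by
  induction g using QuotientGroup.induction_on with
  | H g =>
  rw [infinityPoint, pgl2_smul_mk _ _ _ (map_mulVec_ne_zero _ fun h => one_ne_zero (congrFun h 0)),
      Projectivization.mk_eq_mk_iff'] at hinf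
  rw [affinePoint, pgl2_smul_mk _ _ _ (map_mulVec_ne_zero _ fun h => one_ne_zero (congrFun h 1)),
      Projectivization.mk_eq_mk_iff'] at hzero
  obtain ⟨s, hs⟩ := hinf
  obtain ⟨t, ht⟩ := hzero
  have h10 : g 1 0 = 0 := by
    have := congrFun hs 1
    apply (algebraMap K (AlgebraicClosure K)).injective
    simpa [Matrix.mulVec, dotProduct] using this.symm
  have h01 : g 0 1 = 0 := by
    have := congrFun ht 0
    apply (algebraMap K (AlgebraicClosure K)).injective
    simpa [Matrix.mulVec, dotProduct] using this.symm
  have hdet : g 0 0 * g 1 1 ≠ 0 := by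
    have := (Matrix.isUnit_iff_isUnit_det _).1 g.isUnit
    rw [Matrix.det_fin_two, h10, mul_zero, sub_zero] at this
    exact this.ne_zero
  obtain ⟨h00, h11⟩ := mul_ne_zero_iff.1 hdet
  refine ⟨Units.mk0 (g 0 0 / g 1 1) (div_ne_zero h00 h11), fun a => ?_⟩
  rw [affinePoint, pgl2_smul_mk _ _ _ (map_mulVec_ne_zero _ fun h => one_ne_zero (congrFun h 1)),
      affinePoint, Projectivization.mk_eq_mk_iff']
  refine ⟨algebraMap K _ (g 1 1), funext fun i => ?_⟩
  have h11' : algebraMap K (AlgebraicClosure K) (g 1 1) ≠ 0 := by simpa using h11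
  fin_cases i
  · simp [Matrix.mulVec, dotProduct, h01]
    field_simp
  · simp [Matrix.mulVec, dotProduct, h10]

section Finite

variable [Fintype K]

local notation "Frob" => frobP1 (Fintype.card K)

theorem frobP1_infinityPoint :
    Frob (infinityPoint K) = infinityPoint K := by
  have key : (fun i => (![1, 0] : Fin 2 → AlgebraicClosure K) i ^ Fintype.card K) = ![1, 0] := by
    ext i
    fin_cases i <;> simp
  rw [infinityPoint, frobP1_mk _ _ (by rw [key]; exact fun h => one_ne_zero (congrFun h 0))]
  congr 1

theorem frobP1_affinePoint (a : AlgebraicClosure K) :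
    Frob (affinePoint a) = affinePoint (a ^ Fintype.card K) := by
  have key : (fun i => (![a, 1] : Fin 2 → AlgebraicClosure K) i ^ Fintype.card K) =
      ![a ^ Fintype.card K, 1] := by
    ext i
    fin_cases i <;> simp
  rw [affinePoint, frobP1_mk _ _ (by rw [key]; exact fun h => one_ne_zero (congrFun h 1))]
  simp only [key, affinePoint]

theorem frobP1_smul (g : PGL2 K) (x : ClosureLine K) : Frob (g • x) = g • Frob x := by
  induction g using QuotientGroup.induction_on with
  | H g =>
  induction x using Projectivization.ind with
  | h v hv =>
    have hpow : ∀ w : Fin 2 → AlgebraicClosure K, w ≠ 0 → (fun i => w i ^ Fintype.card K) ≠ 0 := by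
      intro w hw h
      exact hw (funext fun i => eq_zero_of_pow_eq_zero (congrFun h i))
    rw [pgl2_smul_mk g v hv (map_mulVec_ne_zero g hv),
      frobP1_mk _ _ (hpow _ (map_mulVec_ne_zero g hv)), frobP1_mk _ _ (hpow _ hv),
      pgl2_smul_mk g _ _ (map_mulVec_ne_zero g (hpow _ hv))]
    congr 1
    ext i
    change FiniteField.frobeniusAlgHom K (AlgebraicClosure K) _ = _
    simp only [Matrix.mulVec, dotProduct, Matrix.map_apply, map_sum, map_mul, AlgHom.commutes]
    rfl

theorem ncard_pow_card_pow_eq_self (n : ℕ) (hn : n ≠ 0) :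
    {a : AlgebraicClosure K | a ^ Fintype.card K ^ n = a}.ncard = Fintype.card K ^ n := by
  obtain ⟨p, hp⟩ := CharP.exists K
  have : CharP (AlgebraicClosure K) p := charP_of_injective_algebraMap' K p
  obtain ⟨m, hpm, hm⟩ := FiniteField.card K p
  have hsep : (X ^ Fintype.card K ^ n - X : (AlgebraicClosure K)[X]).Separable :=
    galois_poly_separable p _ (hm ▸ dvd_pow (dvd_pow_self p m.ne_zero) hn)
  have hne := FiniteField.X_pow_card_pow_sub_X_ne_zero (AlgebraicClosure K) hn
    (Fintype.one_lt_card (α := K))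
  have hcard := card_rootSet_eq_natDegree (K := AlgebraicClosure K) hsep
    (IsAlgClosed.splits _)
  rw [FiniteField.X_pow_card_pow_sub_X_natDegree_eq _ hn Fintype.one_lt_card,
    Fintype.card_eq_nat_card, Nat.card_coe_set_eq] at hcard
  refine Eq.trans (congrArg Set.ncard ?_) hcard
  ext a
  simp [mem_rootSet, hne, sub_eq_zero]

theorem exists_algebraMap_of_pow_card_eq_self {a : AlgebraicClosure K}
    (ha : a ^ Fintype.card K = a) : ∃ b : K, algebraMap K (AlgebraicClosure K) b = a := by
  have hcard := ncard_pow_card_pow_eq_self (K := K) 1 one_ne_zero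
  rw [pow_one] at hcard
  have h := Set.eq_of_subset_of_ncard_le
    (s := Set.range (algebraMap K (AlgebraicClosure K)))
    (t := {a : AlgebraicClosure K | a ^ Fintype.card K = a})
    (by rintro _ ⟨b, rfl⟩; simp [← map_pow, FiniteField.pow_card])
    (by rw [hcard, ← Set.image_univ, Set.ncard_image_of_injective _ (algebraMap K _).injective,
          Set.ncard_univ, Nat.card_eq_fintype_card])
    (Set.finite_of_ncard_ne_zero (by rw [hcard]; exact Fintype.card_ne_zero))
  have : a ∈ Set.range (algebraMap K (AlgebraicClosure K)) := h ▸ ha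
  exact this

theorem exists_coordinates_of_frobP1_eq_self {x : ClosureLine K} (hx : Frob x = x) :
    ∃ (v : Fin 2 → K) (hv : (fun i => algebraMap K (AlgebraicClosure K) (v i)) ≠ 0),
      x = Projectivization.mk _ _ hv := by
  rcases eq_infinityPoint_or_affinePoint x with rfl | ⟨a, rfl⟩
  · refine ⟨![1, 0], fun h => by simpa using congrFun h 0, ?_⟩
    rw [infinityPoint, Projectivization.mk_eq_mk_iff']
    exact ⟨1, by ext i; fin_cases i <;> simp⟩
  · rw [frobP1_affinePoint] at hx
    obtain ⟨b, rfl⟩ := exists_algebraMap_of_pow_card_eq_self (affinePoint_injective hx)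
    refine ⟨![b, 1], fun h => by simpa using congrFun h 1, ?_⟩
    rw [affinePoint, Projectivization.mk_eq_mk_iff']
    exact ⟨1, by ext i; fin_cases i <;> simp⟩

theorem exists_smul_infinityPoint_affinePoint_zero {x y : ClosureLine K} (hx : Frob x = x)
    (hy : Frob y = y) (hxy : x ≠ y) :
    ∃ g : PGL2 K, g • infinityPoint K = x ∧ g • affinePoint 0 = y := by
  obtain ⟨u, hu, rfl⟩ := exists_coordinates_of_frobP1_eq_self hx
  obtain ⟨v, hv, rfl⟩ := exists_coordinates_of_frobP1_eq_self hy
  have hdet : (!![u 0, v 0; u 1, v 1] : Matrix (Fin 2) (Fin 2) K).det ≠ 0 := by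
    rw [Matrix.det_fin_two_of]
    intro h
    have h' : u 0 * v 1 = v 0 * u 1 := sub_eq_zero.1 h
    apply hxy
    by_cases h0 : v 0 = 0
    · have h1 : v 1 ≠ 0 := by
        intro h1
        apply hv
        ext i
        fin_cases i <;> simp [h0, h1]
      have hu0 : u 0 = 0 := by simpa [h0, h1] using h'
      refine (Projectivization.mk_eq_mk_iff' _ _ _ _ _).2
        ⟨algebraMap K _ (u 1 / v 1), funext fun i => ?_⟩
      fin_cases i <;> simp [h0, hu0, h1]
    · refine (Projectivization.mk_eq_mk_iff' _ _ _ _ _).2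
        ⟨algebraMap K _ (u 0 / v 0), funext fun i => ?_⟩
      rw [Pi.smul_apply, smul_eq_mul, ← map_mul]
      congr 1
      fin_cases i
      · simp [h0]
      · simp only [Fin.mk_one]
        field_simp
        exact h'
  refine ⟨QuotientGroup.mk (Matrix.GeneralLinearGroup.mkOfDetNeZero _ hdet), ?_, ?_⟩
  · rw [infinityPoint,
      pgl2_smul_mk _ _ _ (map_mulVec_ne_zero _ fun h => one_ne_zero (congrFun h 0)),
      Projectivization.mk_eq_mk_iff']
    refine ⟨1, funext fun i => ?_⟩
    fin_cases i <;> simp [Matrix.GeneralLinearGroup.mkOfDetNeZero, Matrix.mulVec, dotProduct]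
  · rw [affinePoint, pgl2_smul_mk _ _ _ (map_mulVec_ne_zero _ fun h => one_ne_zero (congrFun h 1)),
      Projectivization.mk_eq_mk_iff']
    refine ⟨1, funext fun i => ?_⟩
    fin_cases i <;> simp [Matrix.GeneralLinearGroup.mkOfDetNeZero, Matrix.mulVec, dotProduct]

/-- Elements of the quartic extension of `K` lying outside the quadratic one. -/
abbrev QuarticElement (K : Type*) [Field K] [Fintype K] :=
  {a : AlgebraicClosure K // a ^ Fintype.card K ^ 4 = a ∧ a ^ Fintype.card K ^ 2 ≠ a}

theorem card_quarticElement :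
    Nat.card (QuarticElement K) = Fintype.card K ^ 4 - Fintype.card K ^ 2 := by
  have hfin : {a : AlgebraicClosure K | a ^ Fintype.card K ^ 2 = a}.Finite := by
    refine Set.finite_of_ncard_ne_zero ?_
    rw [ncard_pow_card_pow_eq_self 2 (by norm_num)]
    exact pow_ne_zero _ Fintype.card_ne_zero
  rw [← ncard_pow_card_pow_eq_self (K := K) 4 (by norm_num),
    ← ncard_pow_card_pow_eq_self (K := K) 2 (by norm_num), ← Set.ncard_sdiff _ hfin]
  · rw [← Nat.card_coe_set_eq]
    rfl
  · intro a (ha : _ = _)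
    change _ = _
    rw [show Fintype.card K ^ 4 = Fintype.card K ^ 2 * Fintype.card K ^ 2 by ring, pow_mul, ha, ha]

theorem QuarticElement.ne_zero (a : QuarticElement K) : a.1 ≠ 0 := by
  intro h
  apply a.2.2
  rw [h, zero_pow (pow_ne_zero _ Fintype.card_ne_zero)]

noncomputable instance : SMul Kˣ (QuarticElement K) where
  smul c a := ⟨algebraMap K _ c * a.1, by
    have hc (n : ℕ) : algebraMap K (AlgebraicClosure K) c ^ Fintype.card K ^ n =
        algebraMap K _ c := by
      rw [← map_pow, FiniteField.pow_card_pow]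
    rw [mul_pow, mul_pow, hc, hc, a.2.1]
    exact ⟨rfl, fun h => a.2.2 (mul_left_cancel₀ (by simp) h)⟩⟩

theorem QuarticElement.coe_smul (c : Kˣ) (a : QuarticElement K) :
    (c • a).1 = algebraMap K _ c * a.1 := rfl

/-- The tuples of six points whose first four points form a Frobenius orbit and whose last two
points are rational. -/
abbrev FrobeniusTuple (K : Type*) [Field K] [Fintype K] :=
  {x : Fin 6 → ClosureLine K //
    Function.Injective x ∧
    frobP1 (Fintype.card K) (x 0) = x 1 ∧
    frobP1 (Fintype.card K) (x 1) = x 2 ∧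
    frobP1 (Fintype.card K) (x 2) = x 3 ∧
    frobP1 (Fintype.card K) (x 3) = x 0 ∧
    frobP1 (Fintype.card K) (x 4) = x 4 ∧
    frobP1 (Fintype.card K) (x 5) = x 5}

/-- The tuple `([a : 1], [a ^ q : 1], [a ^ q² : 1], [a ^ q³ : 1], [1 : 0], [0 : 1])`. -/
noncomputable def normalTuple (a : AlgebraicClosure K) : Fin 6 → ClosureLine K :=
  ![affinePoint a, affinePoint (a ^ Fintype.card K), affinePoint (a ^ Fintype.card K ^ 2),
    affinePoint (a ^ Fintype.card K ^ 3), infinityPoint K, affinePoint 0]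

theorem normalTuple_injective {a : AlgebraicClosure K} (h4 : a ^ Fintype.card K ^ 4 = a)
    (h2 : a ^ Fintype.card K ^ 2 ≠ a) : Function.Injective (normalTuple a) := by
  have h0 : a ≠ 0 := QuarticElement.ne_zero ⟨a, h4, h2⟩
  set q := Fintype.card K with hq
  have hF : Function.Injective (fun b : AlgebraicClosure K => b ^ q) :=
    (FiniteField.frobeniusAlgHom K (AlgebraicClosure K)).injective
  have e2 : a ^ q ^ 2 = (a ^ q) ^ q := by ring
  have e3 : a ^ q ^ 3 = ((a ^ q) ^ q) ^ q := by ring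
  have e4 : a ^ q ^ 4 = (((a ^ q) ^ q) ^ q) ^ q := by ring
  rw [e4] at h4
  rw [e2] at h2
  have h1 : a ^ q ≠ a := fun h => h2 (by rw [h, h])
  have h3 : ((a ^ q) ^ q) ^ q ≠ a := fun h => h1 (by rw [h] at h4; exact h4)
  have h12 : (a ^ q) ^ q ≠ a ^ q := fun h => h1 (hF h)
  have h13 : ((a ^ q) ^ q) ^ q ≠ a ^ q := fun h => h2 (hF h)
  have h23 : ((a ^ q) ^ q) ^ q ≠ (a ^ q) ^ q := fun h => h12 (hF h)
  have hinf (b : AlgebraicClosure K) := affinePoint_ne_infinityPoint b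
  have hq0 : q ≠ 0 := Fintype.card_ne_zero
  intro i j
  unfold normalTuple
  rw [← hq, e2, e3]
  fin_cases i <;> fin_cases j <;>
    simp [affinePoint_injective.eq_iff, hinf, (hinf _).symm, h0, h0.symm, h1, h1.symm, h2, h2.symm,
      h3, h3.symm, h12, h12.symm, h13, h13.symm, h23, h23.symm, hq0,
      eq_comm (a := (0 : AlgebraicClosure K))]

/-- The normal form attached to a quartic element, as a Frobenius tuple. -/
noncomputable def quarticTuple (a : QuarticElement K) : FrobeniusTuple K :=
  ⟨normalTuple a.1, normalTuple_injective a.2.1 a.2.2, by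
    simp only [normalTuple, Fin.isValue]
    refine ⟨frobP1_affinePoint _, ?_, ?_, ?_, frobP1_infinityPoint, ?_⟩
    · exact (frobP1_affinePoint _).trans (congrArg affinePoint (by ring))
    · exact (frobP1_affinePoint _).trans (congrArg affinePoint (by ring))
    · refine (frobP1_affinePoint _).trans (congrArg affinePoint ?_)
      rw [← pow_mul, ← pow_succ]
      exact a.2.1
    · refine (frobP1_affinePoint _).trans (congrArg affinePoint ?_)
      exact zero_pow Fintype.card_ne_zero⟩

/-- The equivalence relation on Frobenius tuples given by the action of `PGL₂(K)`. -/
noncomputable abbrev frobeniusTupleSetoid (K : Type*) [Field K] [Fintype K] :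
    Setoid (FrobeniusTuple K) :=
  Setoid.comap Subtype.val (MulAction.orbitRel (PGL2 K) (Fin 6 → ClosureLine K))

theorem frobeniusTupleSetoid_iff {x y : FrobeniusTuple K} :
    frobeniusTupleSetoid K x y ↔ ∃ g : PGL2 K, ∀ i, g • y.1 i = x.1 i := by
  rw [Setoid.comap_rel, MulAction.orbitRel_apply, MulAction.mem_orbit_iff]
  simp only [funext_iff, Pi.smul_apply]

theorem quarticTuple_rel_iff {a b : QuarticElement K} :
    frobeniusTupleSetoid K (quarticTuple a) (quarticTuple b) ↔ ∃ c : Kˣ, c • b = a := by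
  rw [frobeniusTupleSetoid_iff]
  constructor
  · rintro ⟨g, hg⟩
    obtain ⟨c, hc⟩ := exists_scaling_of_smul_eq (hg 4) (hg 5)
    exact ⟨c, Subtype.ext (affinePoint_injective ((hc b.1).symm.trans (hg 0)))⟩
  · rintro ⟨c, rfl⟩
    obtain ⟨g, hinf, hg⟩ := exists_smul_eq_affinePoint_mul c
    have hpow (n : ℕ) : algebraMap K (AlgebraicClosure K) c ^ Fintype.card K ^ n =
        algebraMap K _ c := by
      rw [← map_pow, FiniteField.pow_card_pow]
    have hpow1 := hpow 1
    rw [pow_one] at hpow1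
    refine ⟨g, fun i => ?_⟩
    fin_cases i <;>
      simp [quarticTuple, normalTuple, hg, hinf, QuarticElement.coe_smul, mul_pow, hpow, hpow1]

theorem exists_quarticTuple_rel (x : FrobeniusTuple K) :
    ∃ a : QuarticElement K, frobeniusTupleSetoid K (quarticTuple a) x := by
  obtain ⟨x, hinj, h0, h1, h2, h3, h4, h5⟩ := x
  obtain ⟨g, hg4, hg5⟩ := exists_smul_infinityPoint_affinePoint_zero h4 h5 (hinj.ne (by decide))
  have hy4 : g⁻¹ • x 4 = infinityPoint K := by rw [← hg4, inv_smul_smul]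
  have hy5 : g⁻¹ • x 5 = affinePoint 0 := by rw [← hg5, inv_smul_smul]
  have hne : g⁻¹ • x 0 ≠ infinityPoint K := by
    rw [← hy4]
    exact (MulAction.injective g⁻¹).ne (hinj.ne (by decide))
  obtain ⟨a, ha⟩ := (eq_infinityPoint_or_affinePoint _).resolve_left hne
  have hy1 : g⁻¹ • x 1 = affinePoint (a ^ Fintype.card K) := by
    rw [← h0, ← frobP1_smul, ha, frobP1_affinePoint]
  have hy2 : g⁻¹ • x 2 = affinePoint (a ^ Fintype.card K ^ 2) := by
    rw [← h1, ← frobP1_smul, hy1, frobP1_affinePoint, ← pow_mul, ← pow_two]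
  have hy3 : g⁻¹ • x 3 = affinePoint (a ^ Fintype.card K ^ 3) := by
    rw [← h2, ← frobP1_smul, hy2, frobP1_affinePoint, ← pow_mul, ← pow_succ]
  have hy0 : affinePoint a = affinePoint (a ^ Fintype.card K ^ 4) := by
    rw [← ha, ← h3, ← frobP1_smul, hy3, frobP1_affinePoint, ← pow_mul, ← pow_succ]
  refine ⟨⟨a, (affinePoint_injective hy0).symm, fun h => ?_⟩, ?_⟩
  · rw [h, ← ha] at hy2
    exact absurd (hinj (MulAction.injective g⁻¹ hy2)) (by decide)
  · rw [frobeniusTupleSetoid_iff]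
    refine ⟨g⁻¹, fun i => ?_⟩
    fin_cases i <;> simp [quarticTuple, normalTuple, *]

theorem card_units_mul_card_orbits :
    Nat.card Kˣ * Nat.card (Quotient (frobeniusTupleSetoid K)) = Nat.card (QuarticElement K) := by
  have hsurj (o : Quotient (frobeniusTupleSetoid K)) :
      ∃ a : QuarticElement K, Quotient.mk _ (quarticTuple a) = o := by
    induction o using Quotient.ind with
    | _ x => exact (exists_quarticTuple_rel x).imp fun a ha => Quotient.sound ha
  choose s hs using hsurj
  have hmk (c : Kˣ) (a : QuarticElement K) : Quotient.mk (frobeniusTupleSetoid K)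
      (quarticTuple (c • a)) = Quotient.mk _ (quarticTuple a) :=
    Quotient.sound (quarticTuple_rel_iff.2 ⟨c, rfl⟩)
  rw [← Nat.card_prod]
  refine Nat.card_eq_of_bijective (fun p : Kˣ × _ => p.1 • s p.2) ⟨?_, fun a => ?_⟩
  · rintro ⟨c, o⟩ ⟨d, o'⟩ h
    have ho : o = o' := by
      rw [← hs o, ← hs o', ← hmk c (s o), ← hmk d (s o')]
      exact congrArg (fun a => Quotient.mk (frobeniusTupleSetoid K) (quarticTuple a)) h
    subst ho
    have h' := mul_right_cancel₀ (s o).ne_zero (congrArg Subtype.val h)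
    exact Prod.ext (Units.ext ((algebraMap K (AlgebraicClosure K)).injective h')) rfl
  · obtain ⟨c, hc⟩ := quarticTuple_rel_iff.1
      (Quotient.exact (hs (Quotient.mk _ (quarticTuple a))).symm)
    exact ⟨(c, _), hc⟩

theorem card_frobeniusTuple_orbits :
    Nat.card (Quotient (frobeniusTupleSetoid K)) = Fintype.card K ^ 3 + Fintype.card K ^ 2 := by
  have h := card_units_mul_card_orbits (K := K)
  rw [card_quarticElement, Nat.card_units, Nat.card_eq_fintype_card] at h
  obtain ⟨m, hm⟩ := Nat.exists_eq_add_of_lt (Fintype.one_lt_card (α := K))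
  rw [hm] at h ⊢
  refine Nat.eq_of_mul_eq_mul_left (Nat.succ_pos m) ?_
  rw [show m.succ = 1 + m + 1 - 1 by omega, h]
  apply Nat.sub_eq_of_eq_add
  rw [show 1 + m + 1 - 1 = m + 1 by omega]
  ring

end Finite

end CountingFrobeniusOrbits

/-- the number of `PGL₂(K)`-orbits of injective 6-tuples on `P¹(K̄)`
satisfying the stated Frobenius conditions. -/
theorem statement10 (q : ℕ) (hq : IsPrimePow q)
    (K : Type*) [Field K] [Fintype K] (hK : Fintype.card K = q) :
    (Nat.card (Quotient (Setoid.comap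
      (Subtype.val :
        {x : Fin 6 → Projectivization (AlgebraicClosure K) (Fin 2 → AlgebraicClosure K) //
          Function.Injective x ∧
          frobP1 q (x 0) = x 1 ∧
          frobP1 q (x 1) = x 2 ∧
          frobP1 q (x 2) = x 3 ∧
          frobP1 q (x 3) = x 0 ∧
          frobP1 q (x 4) = x 4 ∧
          frobP1 q (x 5) = x 5} →
        (Fin 6 → Projectivization (AlgebraicClosure K) (Fin 2 → AlgebraicClosure K)))
      (MulAction.orbitRel (PGL2 K)
        (Fin 6 → Projectivization (AlgebraicClosure K) (Fin 2 → AlgebraicClosure K))))) : ℤ)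
    = (q : ℤ) ^ 3 + (q : ℤ) ^ 2 := by
  subst hK
  exact_mod_cast card_frobeniusTuple_orbits (K := K)
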